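/- arXiv:2402.11616 — 7 statements merged into one kernel-verified Lean document; each statement's English description precedes it below -/
import Mathlib

section
/- Suppose that (EM) every 2-coloring f of pairs of natural numbers admits an infinite f-transitive set, and (ADS) every transitive 2-coloring of pairs admits an infinite homogeneous set. Then every 2-coloring of pairs of natural numbers admits an infinite homogeneous set. -/
/-- A set `H ⊆ ℕ` is `f`-homogeneous for color `i` if `f x y = i` for all `x < y` in `H`. -/
def HomogFor (f : ℕ → ℕ → Fin 2) (H : Set ℕ) (i : Fin 2) : Prop :=
  ∀ a ∈ H, ∀ b ∈ H, a < b → f a b = i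

/-- A 2-coloring of pairs `f` is transitive. -/
def TransCol (f : ℕ → ℕ → Fin 2) : Prop :=
  ∀ x y z : ℕ, x < y → y < z → ∀ i : Fin 2, f x y = i → f y z = i → f x z = i

/-- A set `X ⊆ ℕ` is `f`-transitive. -/
def TransOn (f : ℕ → ℕ → Fin 2) (X : Set ℕ) : Prop :=
  ∀ x ∈ X, ∀ y ∈ X, ∀ z ∈ X, x < y → y < z →
    ∀ i : Fin 2, f x y = i → f y z = i → f x z = i

theorem stmt2
    (EM : ∀ f : ℕ → ℕ → Fin 2, ∃ X : Set ℕ, X.Infinite ∧ TransOn f X)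
    (ADS : ∀ f : ℕ → ℕ → Fin 2, TransCol f →
      ∃ H : Set ℕ, H.Infinite ∧ ∃ i : Fin 2, HomogFor f H i) :
    ∀ f : ℕ → ℕ → Fin 2, ∃ H : Set ℕ, H.Infinite ∧ ∃ i : Fin 2, HomogFor f H i := by
  intro f
  obtain ⟨X, hX, hT⟩ := EM f
  have hmono : StrictMono (Nat.nth (· ∈ X)) := Nat.nth_strictMono hX
  have hmem (n : ℕ) : Nat.nth (· ∈ X) n ∈ X := Nat.nth_mem_of_infinite hX n
  obtain ⟨H, hH, i, hi⟩ := ADS (fun x y => f (Nat.nth (· ∈ X) x) (Nat.nth (· ∈ X) y))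
    fun x y z hxy hyz =>
      hT _ (hmem x) _ (hmem y) _ (hmem z) (hmono hxy) (hmono hyz)
  refine ⟨Nat.nth (· ∈ X) '' H, hH.image hmono.injective.injOn, i, ?_⟩
  rintro _ ⟨a, ha, rfl⟩ _ ⟨b, hb, rfl⟩ hab
  exact hi a ha b hb (hmono.lt_iff_lt.mp hab)
end

section
/- Let f be a 2-coloring of pairs of natural numbers, and for each x ∈ ℕ let R_x = {y : y > x and f(x,y) = 1}. If C ⊆ ℕ is infinite and cohesive for the sequence (R_x), and x : ℕ → ℕ is the strictly increasing enumeration of C, then the coloring g defined by g(a,b) = f(x_a, x_b) for a < b is stable. -/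
/-- A 2-coloring of pairs `f` is stable if for every `x` there is a color `i`
such that `f x y = i` for all sufficiently large `y`. -/
def StableCol (f : ℕ → ℕ → Fin 2) : Prop :=
  ∀ a : ℕ, ∃ i : Fin 2, ∃ N : ℕ, ∀ b ≥ N, f a b = i

/-- An infinite set `C` is `R`-cohesive if for every `s`, `C ⊆* R s` or `C ⊆* (ℕ \ R s)`. -/
def Cohesive (R : ℕ → Set ℕ) (C : Set ℕ) : Prop :=
  ∀ s : ℕ, (C \ R s).Finite ∨ (C \ (Set.univ \ R s)).Finite

/-- If `C ⊆* S`, then a strictly increasing enumeration into `C` is eventually in `S`. -/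
theorem StrictMono.exists_forall_ge_mem_of_diff_finite {C S : Set ℕ} {x : ℕ → ℕ}
    (hmono : StrictMono x) (hx : ∀ n, x n ∈ C) (hfin : (C \ S).Finite) :
    ∃ N, ∀ b ≥ N, x b ∈ S := by
  obtain ⟨M, hM⟩ := hfin.bddAbove
  refine ⟨M + 1, fun b hb => ?_⟩
  by_contra hS
  have hle : x b ≤ M := hM ⟨hx b, hS⟩
  have hge : b ≤ x b := hmono.le_apply
  omega

theorem stmt3 (f : ℕ → ℕ → Fin 2) (C : Set ℕ) (x : ℕ → ℕ)
    (hC : C.Infinite)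
    (hcoh : Cohesive (fun n => {y | n < y ∧ f n y = 1}) C)
    (hmono : StrictMono x) (hrange : Set.range x = C) :
    StableCol (fun a b => f (x a) (x b)) := by
  intro a
  have hx : ∀ n, x n ∈ C := fun n => hrange ▸ Set.mem_range_self n
  rcases hcoh (x a) with h | h
  · obtain ⟨N, hN⟩ := hmono.exists_forall_ge_mem_of_diff_finite hx h
    exact ⟨1, N, fun b hb => (hN b hb).2⟩
  · obtain ⟨N, hN⟩ := hmono.exists_forall_ge_mem_of_diff_finite hx h
    refine ⟨0, max N (a + 1), fun b hb => ?_⟩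
    have hlt : x a < x b := hmono (le_of_max_le_right hb)
    have hne : f (x a) (x b) ≠ 1 := fun h1 => (hN b (le_of_max_le_left hb)).2 ⟨hlt, h1⟩
    show f (x a) (x b) = 0
    omega
end

section
/- Suppose that every stable 2-coloring of pairs of natural numbers admits an infinite homogeneous set, and that for every sequence R : ℕ → Set ℕ there exists an infinite R-cohesive set. Then every 2-coloring of pairs of natural numbers admits an infinite homogeneous set. -/
/-- A set that is almost contained in another one is eventually inside it along any
strictly increasing enumeration of its elements. -/
theorem eventually_mem_of_finite_diff {C S : Set ℕ} {e : ℕ → ℕ} (he : StrictMono e)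
    (heC : ∀ n, e n ∈ C) (hfin : (C \ S).Finite) : ∃ N, ∀ b ≥ N, e b ∈ S := by
  obtain ⟨M, hM⟩ := hfin.bddAbove
  refine ⟨M + 1, fun b hb => ?_⟩
  by_contra hbS
  have h₁ : e b ≤ M := hM ⟨heC b, hbS⟩
  have h₂ : b ≤ e b := he.le_apply
  omega

/-- Pulling a coloring back along an increasing enumeration of a set that is cohesive for its
columns gives a stable coloring. -/
theorem Cohesive.stableCol_comp {f : ℕ → ℕ → Fin 2} {C : Set ℕ} {e : ℕ → ℕ}
    (hC : Cohesive (fun a => {b | f a b = 0}) C) (he : StrictMono e) (heC : ∀ n, e n ∈ C) :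
    StableCol fun a b => f (e a) (e b) := by
  intro a
  rcases hC (e a) with hfin | hfin
  · obtain ⟨N, hN⟩ := eventually_mem_of_finite_diff he heC hfin
    exact ⟨0, N, hN⟩
  · obtain ⟨N, hN⟩ := eventually_mem_of_finite_diff he heC hfin
    exact ⟨1, N, fun b hb => Fin.eq_one_of_ne_zero _ (hN b hb).2⟩

theorem HomogFor.image {f : ℕ → ℕ → Fin 2} {H : Set ℕ} {i : Fin 2} {e : ℕ → ℕ}
    (hH : HomogFor (fun a b => f (e a) (e b)) H i) (he : StrictMono e) :
    HomogFor f (e '' H) i := by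
  rintro _ ⟨a, ha, rfl⟩ _ ⟨b, hb, rfl⟩ hab
  exact hH a ha b hb (he.lt_iff_lt.mp hab)

theorem stmt4
    (SRT : ∀ f : ℕ → ℕ → Fin 2, StableCol f →
      ∃ H : Set ℕ, H.Infinite ∧ ∃ i : Fin 2, HomogFor f H i)
    (COH : ∀ R : ℕ → Set ℕ, ∃ C : Set ℕ, C.Infinite ∧ Cohesive R C) :
    ∀ f : ℕ → ℕ → Fin 2, ∃ H : Set ℕ, H.Infinite ∧ ∃ i : Fin 2, HomogFor f H i := by
  intro f
  obtain ⟨C, hCinf, hC⟩ := COH fun a => {b | f a b = 0}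
  have he : StrictMono (Nat.nth (· ∈ C)) := Nat.nth_strictMono hCinf
  obtain ⟨H, hHinf, i, hH⟩ :=
    SRT _ (hC.stableCol_comp he fun n => Nat.nth_mem_of_infinite hCinf n)
  exact ⟨_, hHinf.image he.injective.injOn, i, hH.image he⟩
end

section
/- Suppose that: (SEM) every stable tournament on ℕ admits an infinite transitive subtournament; (SADS) every linear order on ℕ of order type ω+ω* admits an infinite ascending or descending sequence; (COH) for every sequence R : ℕ → Set ℕ there exists an infinite R-cohesive set. Then every 2-coloring of pairs of natural numbers admits an infinite homogeneous set. -/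
/-- `R` is a tournament on ℕ: irreflexive and for `a ≠ b` exactly one of
`R a b`, `R b a` holds. -/
def IsTournament (R : ℕ → ℕ → Prop) : Prop :=
  (∀ a, ¬ R a a) ∧ ∀ a b, a ≠ b → (R a b ↔ ¬ R b a)

/-- A tournament is stable if for every `x`, either `R x y` for all sufficiently large `y`,
or `R y x` for all sufficiently large `y`. -/
def StableTournament (R : ℕ → ℕ → Prop) : Prop :=
  ∀ x : ℕ, (∃ N, ∀ y ≥ N, R x y) ∨ (∃ N, ∀ y ≥ N, R y x)

/-- `H` is a transitive subtournament of `R`. -/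
def TransSub (R : ℕ → ℕ → Prop) (H : Set ℕ) : Prop :=
  ∀ a ∈ H, ∀ b ∈ H, ∀ c ∈ H, R a b → R b c → R a c

/-- `L` is a linear order relation on ℕ. -/
def IsLinearRel (L : ℕ → ℕ → Prop) : Prop :=
  (∀ a, L a a) ∧ (∀ a b, L a b → L b a → a = b) ∧
  (∀ a b c, L a b → L b c → L a c) ∧ (∀ a b, L a b ∨ L b a)

/-- The set of elements with finitely many `L`-predecessors. -/
def FinPreds (L : ℕ → ℕ → Prop) : Set ℕ := {x | {y | L y x ∧ y ≠ x}.Finite}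

/-- The set of elements with finitely many `L`-successors. -/
def FinSuccs (L : ℕ → ℕ → Prop) : Set ℕ := {x | {y | L x y ∧ y ≠ x}.Finite}

/-- A linear order on ℕ has order type `ω + ω*` if the set of elements with finitely many
predecessors and the set of elements with finitely many successors are both infinite
and cover ℕ. -/
def OmegaPlusOmegaStar (L : ℕ → ℕ → Prop) : Prop :=
  (FinPreds L).Infinite ∧ (FinSuccs L).Infinite ∧ FinPreds L ∪ FinSuccs L = Set.univ

/-- An infinite ascending sequence for `L`: an infinite set on which `L` agrees with `≤`. -/
def AscSeq (L : ℕ → ℕ → Prop) (S : Set ℕ) : Prop :=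
  S.Infinite ∧ ∀ a ∈ S, ∀ b ∈ S, a ≤ b → L a b

/-- An infinite descending sequence for `L`: an infinite set on which `L` is reverse to `≤`. -/
def DescSeq (L : ℕ → ℕ → Prop) (S : Set ℕ) : Prop :=
  S.Infinite ∧ ∀ a ∈ S, ∀ b ∈ S, a ≤ b → L b a

/-- On a cohesive set for the sections of `f`, the coloring `f` is stable; `p` enumerates
that set. -/
theorem exists_strictMono_stable (f : ℕ → ℕ → Fin 2) {C : Set ℕ} (hC : C.Infinite)
    (hcoh : Cohesive (fun s => {y | f s y = 1}) C) :
    ∃ p : ℕ → ℕ, StrictMono p ∧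
      ∀ x, (∃ N, ∀ y ≥ N, f (p x) (p y) = 1) ∨ (∃ N, ∀ y ≥ N, f (p x) (p y) ≠ 1) := by
  classical
  have hp : StrictMono (Nat.nth (· ∈ C)) := Nat.nth_strictMono hC
  have hmem : ∀ y, Nat.nth (· ∈ C) y ∈ C := fun y => Nat.nth_mem_of_infinite hC y
  refine ⟨Nat.nth (· ∈ C), hp, fun x => ?_⟩
  refine (hcoh (Nat.nth (· ∈ C) x)).imp (fun h => ?_) (fun h => ?_) <;>
  · obtain ⟨N, hN⟩ := h.bddAbove
    refine ⟨N + 1, fun y hy => ?_⟩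
    by_contra hne
    have hle : Nat.nth (· ∈ C) y ≤ N := hN ⟨hmem y, by simpa using hne⟩
    have := hp.le_apply (x := y)
    omega

/-- The tournament of a 2-coloring: for `x < y`, there is an edge from `x` to `y` exactly when
the pair has color `1`. -/
def colorTournament (g : ℕ → ℕ → Fin 2) (x y : ℕ) : Prop :=
  (x < y ∧ g x y = 1) ∨ (y < x ∧ g y x ≠ 1)

theorem isTournament_colorTournament (g : ℕ → ℕ → Fin 2) :
    IsTournament (colorTournament g) := by
  refine ⟨fun a h => ?_, fun a b hab => ?_⟩
  · simp [colorTournament] at h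
  · rcases lt_or_gt_of_ne hab with h | h <;> simp [colorTournament, h, h.not_gt]

theorem stableTournament_colorTournament {g : ℕ → ℕ → Fin 2}
    (hg : ∀ x, (∃ N, ∀ y ≥ N, g x y = 1) ∨ (∃ N, ∀ y ≥ N, g x y ≠ 1)) :
    StableTournament (colorTournament g) := fun x =>
  (hg x).imp
    (fun ⟨N, hN⟩ => ⟨max N (x + 1), fun y hy => Or.inl ⟨by omega, hN y (by omega)⟩⟩)
    (fun ⟨N, hN⟩ => ⟨max N (x + 1), fun y hy => Or.inr ⟨by omega, hN y (by omega)⟩⟩)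

/-- A transitive tournament, made reflexive, is a linear order. -/
theorem isLinearRel_of_transSub {R : ℕ → ℕ → Prop} (hR : IsTournament R) {H : Set ℕ}
    (hH : TransSub R H) {q : ℕ → ℕ} (hq : Function.Injective q) (hqH : ∀ n, q n ∈ H) :
    IsLinearRel fun a b => a = b ∨ R (q a) (q b) := by
  refine ⟨fun a => Or.inl rfl, ?_, ?_, fun a b => ?_⟩
  · rintro a b (h | h) (h' | h')
    · exact h
    · exact h
    · exact h'.symm
    · exact absurd (hH _ (hqH a) _ (hqH b) _ (hqH a) h h') (hR.1 _)
  · rintro a b c (rfl | h) (rfl | h')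
    · exact Or.inl rfl
    · exact Or.inr h'
    · exact Or.inr h
    · exact Or.inr (hH _ (hqH a) _ (hqH b) _ (hqH c) h h')
  · by_cases hab : a = b
    · exact Or.inl (Or.inl hab)
    · by_cases h : R (q a) (q b)
      · exact Or.inl (Or.inr h)
      · refine Or.inr (Or.inr ?_)
        rwa [hR.2 _ _ (hq.ne (Ne.symm hab))]

/-- A linear order coming from a stable tournament is covered by the elements with finitely many
predecessors and those with finitely many successors. -/
theorem finPreds_union_finSuccs {R : ℕ → ℕ → Prop} (hR : IsTournament R)
    (hs : StableTournament R) {q : ℕ → ℕ} (hq : StrictMono q) :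
    FinPreds (fun a b => a = b ∨ R (q a) (q b)) ∪ FinSuccs (fun a b => a = b ∨ R (q a) (q b))
      = Set.univ := by
  refine Set.eq_univ_of_forall fun x => ?_
  refine (hs (q x)).imp (fun ⟨N, hN⟩ => ?_) (fun ⟨N, hN⟩ => ?_) <;>
  · refine (Set.finite_Iio N).subset fun y hy => ?_
    by_contra hyN
    have h := hN (q y) ((not_lt.mp hyN).trans hq.le_apply)
    rcases hy.1 with h' | h'
    · simp_all
    · exact (hR.2 _ _ (hq.injective.ne hy.2)).mp (by assumption) (by assumption)

theorem exists_descSeq_of_infinite_finSuccs {L : ℕ → ℕ → Prop} (hL : IsLinearRel L)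
    (h : (FinSuccs L).Infinite) : ∃ S, DescSeq L S := by
  obtain ⟨u, -, hu⟩ := exists_seq_of_forall_finset_exists (· ∈ FinSuccs L)
    (fun x y => x < y ∧ L y x) fun s hs => by
      have hfin : (⋃ x ∈ s, ({y | L x y ∧ y ≠ x} ∪ Set.Iic x)).Finite :=
        s.finite_toSet.biUnion fun x hx => (hs x hx).union (Set.finite_Iic x)
      obtain ⟨y, hy, hys⟩ := (h.sdiff hfin).nonempty
      refine ⟨y, hy, fun x hx => ?_⟩
      simp only [Set.mem_iUnion, not_exists] at hys
      have hy' := hys x hx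
      have hlt : x < y := not_le.mp fun hle => hy' (Or.inr hle)
      exact ⟨hlt, (hL.2.2.2 y x).resolve_right fun hxy => hy' (Or.inl ⟨hxy, hlt.ne'⟩)⟩
  have hmono : StrictMono u := fun m n hmn => (hu m n hmn).1
  refine ⟨Set.range u, Set.infinite_range_of_injective hmono.injective, ?_⟩
  rintro _ ⟨m, rfl⟩ _ ⟨n, rfl⟩ hab
  rcases (hmono.le_iff_le.mp hab).eq_or_lt with rfl | hlt
  · exact hL.1 _
  · exact (hu m n hlt).2

theorem exists_ascSeq_of_infinite_finPreds {L : ℕ → ℕ → Prop} (hL : IsLinearRel L)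
    (h : (FinPreds L).Infinite) : ∃ S, AscSeq L S :=
  exists_descSeq_of_infinite_finSuccs (L := fun a b => L b a)
    ⟨hL.1, fun a b h₁ h₂ => hL.2.1 a b h₂ h₁, fun a b c h₁ h₂ => hL.2.2.1 c b a h₂ h₁,
      fun a b => hL.2.2.2 b a⟩ h

/-- The principle SADS extends to linear orders covered by the elements with finitely many
predecessors and those with finitely many successors. -/
theorem exists_ascSeq_or_descSeq
    (SADS : ∀ L : ℕ → ℕ → Prop, IsLinearRel L → OmegaPlusOmegaStar L →
      ∃ S : Set ℕ, AscSeq L S ∨ DescSeq L S)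
    {L : ℕ → ℕ → Prop} (hL : IsLinearRel L) (hcov : FinPreds L ∪ FinSuccs L = Set.univ) :
    ∃ S : Set ℕ, AscSeq L S ∨ DescSeq L S := by
  by_cases hP : (FinPreds L).Infinite
  · by_cases hS : (FinSuccs L).Infinite
    · exact SADS L hL ⟨hP, hS, hcov⟩
    · exact (exists_ascSeq_of_infinite_finPreds hL hP).imp fun _ => Or.inl
  · have hS : (FinSuccs L).Infinite := fun hS =>
      Set.infinite_univ (hcov ▸ (Set.not_infinite.mp hP).union hS)
    exact (exists_descSeq_of_infinite_finSuccs hL hS).imp fun _ => Or.inr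

theorem stmt5
    (SEM : ∀ R : ℕ → ℕ → Prop, IsTournament R → StableTournament R →
      ∃ H : Set ℕ, H.Infinite ∧ TransSub R H)
    (SADS : ∀ L : ℕ → ℕ → Prop, IsLinearRel L → OmegaPlusOmegaStar L →
      ∃ S : Set ℕ, AscSeq L S ∨ DescSeq L S)
    (COH : ∀ R : ℕ → Set ℕ, ∃ C : Set ℕ, C.Infinite ∧ Cohesive R C) :
    ∀ f : ℕ → ℕ → Fin 2, ∃ H : Set ℕ, H.Infinite ∧ ∃ i : Fin 2, HomogFor f H i := by
  intro f
  obtain ⟨C, hC, hcoh⟩ := COH fun s => {y | f s y = 1}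
  obtain ⟨p, hp, hstable⟩ := exists_strictMono_stable f hC hcoh
  let g : ℕ → ℕ → Fin 2 := fun x y => f (p x) (p y)
  have hT := isTournament_colorTournament g
  have hs := stableTournament_colorTournament (g := g) hstable
  obtain ⟨H, hH, htrans⟩ := SEM _ hT hs
  have hq : StrictMono (Nat.nth (· ∈ H)) := Nat.nth_strictMono hH
  have hqH : ∀ n, Nat.nth (· ∈ H) n ∈ H := fun n => Nat.nth_mem_of_infinite hH n
  generalize Nat.nth (· ∈ H) = q at hq hqH
  obtain ⟨S, ⟨hS, hord⟩ | ⟨hS, hord⟩⟩ := exists_ascSeq_or_descSeq SADS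
    (isLinearRel_of_transSub hT htrans hq.injective hqH) (finPreds_union_finSuccs hT hs hq)
  all_goals
    refine ⟨(fun n => p (q n)) '' S, hS.image (hp.comp hq).injective.injOn, ?_⟩
  · refine ⟨1, ?_⟩
    rintro _ ⟨a, ha, rfl⟩ _ ⟨b, hb, rfl⟩ hab
    have hlt : q a < q b := hp.lt_iff_lt.mp hab
    have hlt' : a < b := hq.lt_iff_lt.mp hlt
    rcases hord a ha b hb hlt'.le with h | h | h
    · exact absurd h hlt'.ne
    · exact h.2
    · exact absurd h.1 hlt.not_gt
  · refine ⟨0, ?_⟩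
    rintro _ ⟨a, ha, rfl⟩ _ ⟨b, hb, rfl⟩ hab
    have hlt : q a < q b := hp.lt_iff_lt.mp hab
    have hlt' : a < b := hq.lt_iff_lt.mp hlt
    rcases hord a ha b hb hlt'.le with h | h | h
    · exact absurd h hlt'.ne'
    · exact absurd h.1 hlt.not_gt
    · have h2 : f (p (q a)) (p (q b)) ≠ 1 := h.2
      change f (p (q a)) (p (q b)) = 0
      omega
end

section
/- Let R be a tournament on ℕ, let σ be a finite R-transitive set, and let I ⊆ ℕ be disjoint from σ and included in a minimal interval of σ, meaning there is a partition σ = L ∪ H with R(x,z) for all x ∈ L and z ∈ I, R(z,y) for all z ∈ I and y ∈ H, and R(x,y) for all x ∈ L and y ∈ H. Let ρ_0, …, ρ_{q−1} be finite R-transitive subsets of I and i_0, …, i_{q−1} ∈ {0,1} such that for all s < t < q: if i_s = 0 then R(x,y) for all x ∈ ρ_s and y ∈ ρ_t, and if i_s = 1 then R(y,x) for all x ∈ ρ_s and y ∈ ρ_t. Then σ ∪ ρ_0 ∪ ⋯ ∪ ρ_{q−1} is R-transitive. -/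
/-- A set `F` is `R`-transitive. -/
def RTransOn (R : ℕ → ℕ → Prop) (F : Set ℕ) : Prop :=
  ∀ a ∈ F, ∀ b ∈ F, ∀ c ∈ F, R a b → R b c → R a c

theorem IsTournament.asymm {R : ℕ → ℕ → Prop} (hR : IsTournament R) {a b : ℕ}
    (hab : R a b) : ¬ R b a := by
  rcases eq_or_ne a b with rfl | hne
  · exact hR.1 a
  · exact (hR.2 a b hne).1 hab

theorem RTransOn.mono {R : ℕ → ℕ → Prop} {A B : Set ℕ} (hB : RTransOn R B) (hAB : A ⊆ B) :
    RTransOn R A :=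
  fun a ha b hb c hc => hB a (hAB ha) b (hAB hb) c (hAB hc)

/-- If every element of `A` is `R`-below every element of `B`, transitivity passes to `A ∪ B`. -/
theorem RTransOn.union {R : ℕ → ℕ → Prop} (hR : IsTournament R) {A B : Set ℕ}
    (hA : RTransOn R A) (hB : RTransOn R B) (hAB : ∀ x ∈ A, ∀ y ∈ B, R x y) :
    RTransOn R (A ∪ B) := by
  rintro a (ha | ha) b (hb | hb) c (hc | hc) hab hbc
  · exact hA a ha b hb c hc hab hbc
  · exact hAB a ha c hc
  · exact absurd hbc (hR.asymm (hAB c hc b hb))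
  · exact hAB a ha c hc
  · exact absurd hab (hR.asymm (hAB b hb a ha))
  · exact absurd hab (hR.asymm (hAB b hb a ha))
  · exact absurd hbc (hR.asymm (hAB c hc b hb))
  · exact hB a ha b hb c hc hab hbc

/-- A finite sequence of transitive sets, each of which lies entirely `R`-below or entirely
`R`-above all later ones, has a transitive union. -/
theorem RTransOn.iUnion_fin {R : ℕ → ℕ → Prop} (hR : IsTournament R) {q : ℕ}
    (A : Fin q → Set ℕ) (hA : ∀ s, RTransOn R (A s))
    (hord : ∀ s, (∀ t, s < t → ∀ x ∈ A s, ∀ y ∈ A t, R x y) ∨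
      (∀ t, s < t → ∀ x ∈ A s, ∀ y ∈ A t, R y x)) :
    RTransOn R (⋃ s, A s) := by
  induction q with
  | zero => simp [RTransOn]
  | succ q ih =>
    have hunion : ⋃ s, A s = A 0 ∪ ⋃ s : Fin q, A s.succ := by
      ext x
      simp [Fin.exists_fin_succ]
    have htail : RTransOn R (⋃ s : Fin q, A s.succ) :=
      ih (fun s => A s.succ) (fun s => hA s.succ) fun s =>
        (hord s.succ).imp (fun h t hst => h t.succ (Fin.succ_lt_succ_iff.2 hst))
          (fun h t hst => h t.succ (Fin.succ_lt_succ_iff.2 hst))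
    rw [hunion]
    rcases hord 0 with h | h
    · refine (hA 0).union hR htail fun x hx y hy => ?_
      obtain ⟨t, ht⟩ := Set.mem_iUnion.1 hy
      exact h t.succ t.succ_pos x hx y ht
    · rw [Set.union_comm]
      refine htail.union hR (hA 0) fun x hx y hy => ?_
      obtain ⟨t, ht⟩ := Set.mem_iUnion.1 hx
      exact h t.succ t.succ_pos y hy x ht

theorem stmt9 (R : ℕ → ℕ → Prop) (hR : IsTournament R)
    (σ : Finset ℕ) (hσ : RTransOn R ↑σ)
    (I : Set ℕ) (hdisj : ∀ x ∈ σ, x ∉ I)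
    (hmin : ∃ L H : Finset ℕ, σ = L ∪ H ∧ Disjoint L H ∧
      (∀ x ∈ L, ∀ z ∈ I, R x z) ∧ (∀ z ∈ I, ∀ y ∈ H, R z y) ∧
      (∀ x ∈ L, ∀ y ∈ H, R x y))
    (q : ℕ) (ρ : Fin q → Finset ℕ) (ι : Fin q → Fin 2)
    (hρI : ∀ s, ↑(ρ s) ⊆ I) (hρtrans : ∀ s, RTransOn R ↑(ρ s))
    (horder : ∀ s t : Fin q, s < t →
      (ι s = 0 → ∀ x ∈ ρ s, ∀ y ∈ ρ t, R x y) ∧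
      (ι s = 1 → ∀ x ∈ ρ s, ∀ y ∈ ρ t, R y x)) :
    RTransOn R (↑σ ∪ ⋃ s : Fin q, ↑(ρ s)) := by
  obtain ⟨L, H, rfl, -, hLI, hIH, hLH⟩ := hmin
  have hU : RTransOn R (⋃ s, (ρ s : Set ℕ)) := by
    refine RTransOn.iUnion_fin hR _ hρtrans fun s => ?_
    rcases (by omega : ι s = 0 ∨ ι s = 1) with hs | hs
    · exact Or.inl fun t hst => (horder s t hst).1 hs
    · exact Or.inr fun t hst => (horder s t hst).2 hs
  have hUI : ⋃ s, (ρ s : Set ℕ) ⊆ I := Set.iUnion_subset hρI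
  rw [Finset.coe_union] at hσ ⊢
  rw [Set.union_assoc, Set.union_comm (H : Set ℕ)]
  refine (hσ.mono Set.subset_union_left).union hR
    (hU.union hR (hσ.mono Set.subset_union_right) fun x hx y hy => hIH x (hUI hx) y hy) ?_
  rintro x hx y (hy | hy)
  · exact hLI x hx y (hUI hy)
  · exact hLH x hx y hy
end

section
/- Let A_0, A_1 be a partition of ℕ. Let E be a finite nonempty prefix-closed tree whose nodes are finite sequences of pairs (i, ρ) with i ∈ {0,1} and ρ a finite subset of ℕ. Call a node ν = ⟨(i_0,ρ_0), …, (i_{q−1},ρ_{q−1})⟩ valid if ρ_s ⊆ A_{i_s} for all s < q. Suppose that for every node ν ∈ E that is not a leaf of E, there exists r ∈ ℕ such that for every partition B_0 ⊔ B_1 = {0, …, r−1}, there are i ∈ {0,1} and ρ ⊆ B_i with ν⌢(i,ρ) ∈ E. Then E has a valid leaf. -/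
/-- A node `ν` of the tree is valid (w.r.t. the partition `A 0 ⊔ A 1 = ℕ`) if every
entry `(i, ρ)` appearing in `ν` satisfies `ρ ⊆ A i`. -/
def ValidNode (A : Fin 2 → Set ℕ) (ν : List (Fin 2 × Finset ℕ)) : Prop :=
  ∀ p ∈ ν, ↑p.2 ⊆ A p.1

theorem stmt10 (A : Fin 2 → Set ℕ)
    (hcover : A 0 ∪ A 1 = Set.univ) (hdisj : Disjoint (A 0) (A 1))
    (E : Set (List (Fin 2 × Finset ℕ))) (hfin : E.Finite) (hne : E.Nonempty)
    (hclosed : ∀ ν ∈ E, ∀ μ, μ <+: ν → μ ∈ E)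
    (hstep : ∀ ν ∈ E, (∃ p, ν ++ [p] ∈ E) →
      ∃ r : ℕ, ∀ B : Fin 2 → Finset ℕ,
        B 0 ∪ B 1 = Finset.range r → Disjoint (B 0) (B 1) →
        ∃ i : Fin 2, ∃ ρ : Finset ℕ, ρ ⊆ B i ∧ ν ++ [(i, ρ)] ∈ E) :
    ∃ ν ∈ E, (∀ p, ν ++ [p] ∉ E) ∧ ValidNode A ν := by
  classical
  obtain ⟨ν₀, hν₀⟩ := hne
  obtain ⟨ν, ⟨hν, hvalid⟩, hmax⟩ := Set.exists_max_image {ν ∈ E | ValidNode A ν} List.length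
    (hfin.subset (Set.sep_subset _ _))
    ⟨[], hclosed ν₀ hν₀ [] List.nil_prefix, fun p hp => absurd hp List.not_mem_nil⟩
  refine ⟨ν, hν, fun p hp => ?_, hvalid⟩
  obtain ⟨r, hr⟩ := hstep ν hν ⟨p, hp⟩
  obtain ⟨i, ρ, hρ, hmem⟩ := hr (fun i => (Finset.range r).filter (· ∈ A i))
    (by
      ext x
      have hx : x ∈ A 0 ∪ A 1 := hcover ▸ Set.mem_univ x
      simp only [Finset.mem_union, Finset.mem_filter, ← and_or_left]
      exact and_iff_left hx)
    (Finset.disjoint_left.2 fun x h₀ h₁ =>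
      Set.disjoint_left.1 hdisj (Finset.mem_filter.1 h₀).2 (Finset.mem_filter.1 h₁).2)
  have hvalid' : ValidNode A (ν ++ [(i, ρ)]) := by
    intro q hq
    rcases List.mem_append.1 hq with hq | hq
    · exact hvalid q hq
    · obtain rfl := List.mem_singleton.1 hq
      exact fun x hx => (Finset.mem_filter.1 (hρ hx)).2
  have hlen := hmax _ ⟨hmem, hvalid'⟩
  simp at hlen
end

section
/- For every sequence R : ℕ → Set ℕ of subsets of ℕ there exists an infinite R-cohesive set, i.e., an infinite C ⊆ ℕ such that for every s, either C \ R s is finite or C ∩ R s is finite. -/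
open Filter in
/-- Given countably many sets of naturals and an ultrafilter on `ℕ` containing all cofinite sets,
some strictly increasing sequence eventually decides each set the way the ultrafilter does. -/
theorem Ultrafilter.exists_strictMono_forall_mem_iff (U : Ultrafilter ℕ)
    (hU : (U : Filter ℕ) ≤ atTop) (R : ℕ → Set ℕ) :
    ∃ φ : ℕ → ℕ, StrictMono φ ∧ ∀ n, ∀ s ≤ n, (φ n ∈ R s ↔ R s ∈ U) := by
  refine extraction_forall_of_frequently (P := fun n k => ∀ s ≤ n, (k ∈ R s ↔ R s ∈ U))
    fun n => Frequently.filter_mono ?_ hU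
  refine Eventually.frequently ((eventually_all_finite (Set.finite_Iic n)).2 fun s _ => ?_)
  by_cases h : R s ∈ U
  · filter_upwards [h] with k hk
    exact iff_of_true hk h
  · filter_upwards [Ultrafilter.compl_mem_iff_notMem.2 h] with k hk
    exact iff_of_false hk h

theorem stmt16 (R : ℕ → Set ℕ) :
    ∃ C : Set ℕ, C.Infinite ∧ ∀ s : ℕ, (C \ R s).Finite ∨ (C ∩ R s).Finite := by
  obtain ⟨φ, hφ, h⟩ := (Filter.hyperfilter ℕ).exists_strictMono_forall_mem_iff
    Nat.hyperfilter_le_atTop R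
  refine ⟨Set.range φ, Set.infinite_range_of_injective hφ.injective, fun s => ?_⟩
  by_cases hs : R s ∈ Filter.hyperfilter ℕ
  · left
    refine ((Set.finite_Iio s).image φ).subset ?_
    rintro _ ⟨⟨n, rfl⟩, hn⟩
    exact ⟨n, not_le.1 fun hsn => hn ((h n s hsn).2 hs), rfl⟩
  · right
    refine ((Set.finite_Iio s).image φ).subset ?_
    rintro _ ⟨⟨n, rfl⟩, hn⟩
    exact ⟨n, not_le.1 fun hsn => hs ((h n s hsn).1 hn), rfl⟩
end
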